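/- Let J be a nonsingular J-tensor for the metric g on U, σ = det J, V : U → ℝ smooth, and define the Hamiltonian H(q,p) = (1/2)pᵀ(cof J)(q) G(q) p + V(q) on U × ℝⁿ. Then a smooth curve q : I → U solves the cofactor Newton system d²q^i/dt² + Γ^i_{jk}(dq^j/dt)(dq^k/dt) = −((cof J)⁻¹∇V)^i if and only if the curve (q(t), p(t)) with p(t) = g(q(t)) q̇(t) solves the quasi-Hamiltonian first-order system d(q,p)/dt = (1/σ(q)) Π_nc(J)(q,p) dH(q,p). -/

import Mathlib

noncomputable section
open Matrix

/-- Partial derivative `∂f/∂q^i` of a scalar function on `ℝⁿ`. -/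
def pd {n : ℕ} (f : (Fin n → ℝ) → ℝ) (i : Fin n) (q : Fin n → ℝ) : ℝ :=
  fderiv ℝ f q (Pi.single i 1)

/-- Christoffel symbols `Γ^i_{jk}` of a metric `g` (with `G = g⁻¹`). -/
def christoffel {n : ℕ} (g : (Fin n → ℝ) → Matrix (Fin n) (Fin n) ℝ)
    (i j k : Fin n) (q : Fin n → ℝ) : ℝ :=
  (1 / 2) * ∑ l, (g q)⁻¹ i l *
    (pd (fun q' => g q' l k) j q + pd (fun q' => g q' l j) k q - pd (fun q' => g q' j k) l q)

/-- Gradient with respect to the metric `g`: `(∇V)^i = G^{ij} ∂_j V`. -/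
def grad {n : ℕ} (g : (Fin n → ℝ) → Matrix (Fin n) (Fin n) ℝ)
    (V : (Fin n → ℝ) → ℝ) (q : Fin n → ℝ) : Fin n → ℝ :=
  (g q)⁻¹ *ᵥ (fun j => pd V j q)

/-- Covariant derivative `∇_h J^i_j` of a (1,1)-tensor field. -/
def covDeriv {n : ℕ} (g J : (Fin n → ℝ) → Matrix (Fin n) (Fin n) ℝ)
    (h i j : Fin n) (q : Fin n → ℝ) : ℝ :=
  pd (fun q' => J q' i j) h q
    + ∑ l, christoffel g i h l q * J q l j
    - ∑ l, christoffel g l h j q * J q i l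

/-- `J` is a J-tensor for the metric `g` on `U`: `JG` is symmetric and
`∇_h J^i_j = α_j δ^i_h + α^i g_{jh}` for some 1-form `α`. -/
def IsJTensor {n : ℕ} (U : Set (Fin n → ℝ))
    (g J : (Fin n → ℝ) → Matrix (Fin n) (Fin n) ℝ) : Prop :=
  (∀ i j, ContDiffOn ℝ (⊤ : ℕ∞) (fun q => J q i j) U) ∧
  (∀ q ∈ U, (J q * (g q)⁻¹).IsSymm) ∧
  ∃ α : (Fin n → ℝ) → (Fin n → ℝ), ∀ q ∈ U, ∀ h i j,
    covDeriv g J h i j q =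
      α q j * (if i = h then (1 : ℝ) else 0) + (∑ k, (g q)⁻¹ i k * α q k) * g q j h

/-- The matrix `Ω^i_j = (∂J^k_i/∂q^j − ∂J^k_j/∂q^i) p_k` appearing in the
lower-right block of the noncanonical Poisson operator `Π_nc(J)`. -/
def Omega {n : ℕ} (J : (Fin n → ℝ) → Matrix (Fin n) (Fin n) ℝ)
    (q p : Fin n → ℝ) (i j : Fin n) : ℝ :=
  ∑ k, (pd (fun q' => J q' k i) j q - pd (fun q' => J q' k j) i q) * p k

section CofactorSystems

variable {n : ℕ}

theorem dotProduct_mulVec_of_transpose_eq {ι : Type*} [Fintype ι] {A B : Matrix ι ι ℝ}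
    (h : Aᵀ = B) (x y : ι → ℝ) : x ⬝ᵥ A *ᵥ y = (B *ᵥ x) ⬝ᵥ y := by
  rw [dotProduct_mulVec, ← h, mulVec_transpose]

/-- Jacobi's formula for the derivative of a determinant. -/
theorem pd_det {J : (Fin n → ℝ) → Matrix (Fin n) (Fin n) ℝ} {q : Fin n → ℝ}
    (hJ : ∀ i j, DifferentiableAt ℝ (fun q => J q i j) q) (k : Fin n) :
    pd (fun q => (J q).det) k q
      = trace ((J q).adjugate * of fun i j => pd (fun q => J q i j) k q) := by
  let D : ContinuousMultilinearMap ℝ (fun _ : Fin n => Fin n → ℝ) ℝ :=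
    { (detRowAlternating (R := ℝ) (n := Fin n)).toMultilinearMap with
      cont := Continuous.matrix_det (A := fun A : Fin n → Fin n → ℝ => A) continuous_id }
  let F : (Fin n → ℝ) → Fin n → Fin n → ℝ := fun q i j => J q i j
  have hF : DifferentiableAt ℝ F q := differentiableAt_pi.2 fun i => differentiableAt_pi.2 fun j => hJ i j
  have hD := (D.hasFDerivAt (F q)).comp q hF.hasFDerivAt
  have hrow (i : Fin n) : fderiv ℝ F q (Pi.single k 1) i
      = fun j => pd (fun q => J q i j) k q := by
    funext j
    have h := hasFDerivAt_pi'.1 (hasFDerivAt_pi'.1 hF.hasFDerivAt i) j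
    exact (congrArg (fun L => L (Pi.single k 1)) h.fderiv).symm
  have hdet : pd (fun q => (J q).det) k q
      = ∑ i, ((J q).updateRow i fun j => pd (fun q => J q i j) k q).det := by
    refine (congrArg (fun L => L (Pi.single k 1)) hD.fderiv).trans ?_
    rw [ContinuousLinearMap.comp_apply, ContinuousMultilinearMap.linearDeriv_apply]
    refine Finset.sum_congr rfl fun i _ => ?_
    rw [hrow]
    rfl
  rw [hdet, trace_mul_comm]
  refine Finset.sum_congr rfl fun i _ => ?_
  rw [← cramer_transpose_apply, cramer_eq_adjugate_mulVec, ← adjugate_transpose, mulVec_transpose]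
  rfl

/-- For a J-tensor, `Jᵀ d(det J) = 2 (det J) α`, with `d(det J)` given by Jacobi's formula. -/
theorem trace_adjugate_contraction (g J : Matrix (Fin n) (Fin n) ℝ)
    (Γ dJ : Fin n → Matrix (Fin n) (Fin n) ℝ) (α β : Fin n → ℝ)
    (hβ : g *ᵥ β = α) (hA : g * J.adjugate = J.adjugateᵀ * g)
    (hdJ : ∀ h, dJ h = (of fun i j => α j * (if i = h then (1 : ℝ) else 0) + β i * g j h)
      - Γ h * J + J * Γ h) (hg : gᵀ = g) (i : Fin n) :
    ∑ j, J j i * trace (J.adjugate * dJ j) = 2 * J.det * α i := by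
  have htr (j : Fin n) : trace (J.adjugate * dJ j) = 2 * (J.adjugateᵀ *ᵥ α) j := by
    have hΓ : trace (J.adjugate * (Γ j * J)) = trace (J.adjugate * (J * Γ j)) := by
      rw [← Matrix.mul_assoc, trace_mul_comm, ← Matrix.mul_assoc, ← Matrix.mul_assoc,
        mul_adjugate, adjugate_mul]
    have hN : trace (J.adjugate * of fun i k => α k * (if i = j then (1 : ℝ) else 0) + β i * g k j)
        = (J.adjugateᵀ *ᵥ α) j + ((g * J.adjugate) *ᵥ β) j := by
      simp only [trace, diag, mul_apply, of_apply, mulVec, dotProduct, transpose_apply, mul_add,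
        Finset.sum_add_distrib, mul_ite, mul_one, mul_zero, Finset.sum_ite_eq', Finset.mem_univ,
        if_true, Finset.sum_mul]
      congr 1
      rw [Finset.sum_comm]
      refine Finset.sum_congr rfl fun a _ => Finset.sum_congr rfl fun b _ => ?_
      rw [← congrFun (congrFun hg j) b, transpose_apply]
      ring
    rw [hdJ, mul_add, mul_sub, trace_add, trace_sub, hΓ, hN, hA, ← mulVec_mulVec, hβ]
    ring
  have key : Jᵀ *ᵥ (J.adjugateᵀ *ᵥ α) = J.det • α := by
    rw [mulVec_mulVec, ← transpose_mul, adjugate_mul, transpose_smul, transpose_one, smul_mulVec,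
      one_mulVec]
  have := congrFun key i
  simp only [mulVec, dotProduct, transpose_apply, Pi.smul_apply, smul_eq_mul] at this
  simp only [htr, mulVec, dotProduct, transpose_apply]
  rw [mul_assoc, ← this, Finset.mul_sum]
  exact Finset.sum_congr rfl fun j _ => by ring

/-- Identity equating the geodesic force `½ ∂ᵢ g (v, v)` to the kinetic force terms
of the quasi-Hamiltonian system. -/
theorem kinetic_identity (g J : Matrix (Fin n) (Fin n) ℝ)
    (Γ dg dJ : Fin n → Matrix (Fin n) (Fin n) ℝ) (α β : Fin n → ℝ)
    (hβ : g *ᵥ β = α) (hg : gᵀ = g) (hJ : (g * J)ᵀ = g * J)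
    (hdg : ∀ h, dg h = g * Γ h + (g * Γ h)ᵀ)
    (hΓ : ∀ h i j, Γ h i j = Γ j i h)
    (hdJ : ∀ h, dJ h = (of fun i j => α j * (if i = h then (1 : ℝ) else 0) + β i * g j h)
      - Γ h * J + J * Γ h) (w v p : Fin n → ℝ) (hv : v = J *ᵥ w) (hp : p = g *ᵥ v) (i : Fin n) :
    (1 / 2) * (v ⬝ᵥ dg i *ᵥ v)
      = - (α i * (w ⬝ᵥ p)) + (1 / 2) * ∑ j, J j i * (w ⬝ᵥ (dg j * J + g * dJ j) *ᵥ w)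
        + ∑ j, (∑ k, (dJ j k i - dJ i k j) * p k) * w j := by
  have hp' : p = (g * J) *ᵥ w := by rw [hp, hv, mulVec_mulVec]
  have hN (h : Fin n) (x : Fin n → ℝ) :
      (of fun i j => α j * (if i = h then (1 : ℝ) else 0) + β i * g j h) *ᵥ x
        = (α ⬝ᵥ x) • (Pi.single h 1 : Fin n → ℝ) + (g *ᵥ x) h • β := by
    funext a
    simp only [mulVec, dotProduct, of_apply, Pi.add_apply, Pi.smul_apply, smul_eq_mul, add_mul,
      Finset.sum_add_distrib, Pi.single_apply, Finset.sum_mul]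
    congr 1
    · exact Finset.sum_congr rfl fun b _ => by ring
    · refine Finset.sum_congr rfl fun b _ => ?_
      rw [← congrFun (congrFun hg h) b, transpose_apply]
      ring
  have hdJv (h : Fin n) (x : Fin n → ℝ) : dJ h *ᵥ x
      = (α ⬝ᵥ x) • (Pi.single h 1 : Fin n → ℝ) + (g *ᵥ x) h • β - Γ h *ᵥ (J *ᵥ x)
        + J *ᵥ (Γ h *ᵥ x) := by
    rw [hdJ, add_mulVec, sub_mulVec, hN, mulVec_mulVec, mulVec_mulVec]
  have hdgv (h : Fin n) (x y : Fin n → ℝ) : x ⬝ᵥ dg h *ᵥ y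
      = (g *ᵥ x) ⬝ᵥ Γ h *ᵥ y + (g *ᵥ y) ⬝ᵥ Γ h *ᵥ x := by
    rw [hdg, add_mulVec, dotProduct_add, dotProduct_mulVec_of_transpose_eq (transpose_transpose _),
      ← mulVec_mulVec, ← mulVec_mulVec, dotProduct_mulVec_of_transpose_eq hg,
      dotProduct_comm _ y, dotProduct_mulVec_of_transpose_eq hg]
  have hL (j : Fin n) : w ⬝ᵥ (dg j * J + g * dJ j) *ᵥ w
      = 2 * (p ⬝ᵥ Γ j *ᵥ w) + 2 * ((α ⬝ᵥ w) * (g *ᵥ w) j) := by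
    have h1 (x : Fin n → ℝ) : (g *ᵥ w) ⬝ᵥ J *ᵥ x = p ⬝ᵥ x := by
      rw [← dotProduct_mulVec_of_transpose_eq hg, mulVec_mulVec,
        dotProduct_mulVec_of_transpose_eq hJ, hp']
    have h2 : (g *ᵥ w) ⬝ᵥ β = α ⬝ᵥ w := by
      rw [← dotProduct_mulVec_of_transpose_eq hg, hβ, dotProduct_comm]
    rw [add_mulVec, ← mulVec_mulVec, ← mulVec_mulVec, dotProduct_add, ← hv, hdgv, ← hp,
      dotProduct_mulVec_of_transpose_eq hg, hdJv, dotProduct_add, dotProduct_sub, dotProduct_add,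
      dotProduct_smul, dotProduct_smul, h1, h2, ← hv, dotProduct_single_one]
    simp only [smul_eq_mul]
    ring
  have hΓw (x y : Fin n → ℝ) : ∑ j, y j • (Γ j *ᵥ x) = ∑ j, x j • (Γ j *ᵥ y) := by
    funext a
    simp only [Finset.sum_apply, Pi.smul_apply, smul_eq_mul, mulVec, dotProduct, Finset.mul_sum]
    rw [Finset.sum_comm]
    refine Finset.sum_congr rfl fun b _ => Finset.sum_congr rfl fun d _ => ?_
    rw [hΓ d a b]
    ring
  have hΩ : ∑ j, (∑ k, (dJ j k i - dJ i k j) * p k) * w j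
      = ∑ j, w j * (p ⬝ᵥ dJ j *ᵥ Pi.single i 1) - p ⬝ᵥ dJ i *ᵥ w := by
    simp only [mulVec_single_one]
    simp only [mulVec, dotProduct, sub_mul, Finset.sum_sub_distrib, Finset.mul_sum,
      Finset.sum_mul, col_apply]
    congr 1
    · exact Finset.sum_congr rfl fun b _ => Finset.sum_congr rfl fun d _ => by ring
    · rw [Finset.sum_comm]
      exact Finset.sum_congr rfl fun b _ => Finset.sum_congr rfl fun d _ => by ring
  have hS1 : ∑ j, w j * (p ⬝ᵥ Γ j *ᵥ (J *ᵥ Pi.single i 1)) = ∑ j, J j i * (p ⬝ᵥ Γ j *ᵥ w) := by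
    have := congrArg (p ⬝ᵥ ·) (hΓw (J *ᵥ Pi.single i 1) w)
    simpa only [dotProduct_sum, dotProduct_smul, smul_eq_mul, mulVec_single_one, col_apply]
      using this
  have hS2 : ∑ j, w j * (p ⬝ᵥ J *ᵥ (Γ j *ᵥ Pi.single i 1)) = p ⬝ᵥ J *ᵥ (Γ i *ᵥ w) := by
    have := congrArg (fun x => p ⬝ᵥ J *ᵥ x) (hΓw (Pi.single i 1) w)
    simpa [dotProduct_sum, dotProduct_smul, mulVec_sum, mulVec_smul, Pi.single_apply] using this
  have hgw : ∑ j, w j * (g *ᵥ Pi.single i 1) j = (g *ᵥ w) i := by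
    change w ⬝ᵥ _ = _
    rw [dotProduct_mulVec_of_transpose_eq hg, dotProduct_single_one]
  have hJg : ∑ j, J j i * (g *ᵥ w) j = p i := by
    have : Jᵀ *ᵥ (g *ᵥ w) = p := by
      rw [mulVec_mulVec, hp', ← hJ, transpose_mul, hg]
    rw [← this]
    rfl
  have hαi : α ⬝ᵥ (Pi.single i 1) = α i := dotProduct_single_one _ _
  have hS : ∑ j, w j * (p ⬝ᵥ dJ j *ᵥ Pi.single i 1)
      = α i * (w ⬝ᵥ p) + (g *ᵥ w) i * (p ⬝ᵥ β) - ∑ j, J j i * (p ⬝ᵥ Γ j *ᵥ w)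
        + p ⬝ᵥ J *ᵥ (Γ i *ᵥ w) := by
    rw [← hS1, ← hS2, ← hgw, dotProduct, Finset.mul_sum, Finset.sum_mul,
      ← Finset.sum_add_distrib, ← Finset.sum_sub_distrib, ← Finset.sum_add_distrib]
    refine Finset.sum_congr rfl fun j _ => ?_
    rw [hdJv, dotProduct_add, dotProduct_sub, dotProduct_add, dotProduct_smul, dotProduct_smul,
      hαi, dotProduct_single_one]
    simp only [smul_eq_mul]
    ring
  have hT : ∑ j, J j i * (w ⬝ᵥ (dg j * J + g * dJ j) *ᵥ w)
      = 2 * ∑ j, J j i * (p ⬝ᵥ Γ j *ᵥ w) + 2 * ((α ⬝ᵥ w) * p i) := by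
    rw [← hJg, Finset.mul_sum, Finset.mul_sum, Finset.mul_sum, ← Finset.sum_add_distrib]
    exact Finset.sum_congr rfl fun j _ => by rw [hL]; ring
  rw [hΩ, hS, hT, hdgv, ← hp, hdJv, dotProduct_add, dotProduct_sub, dotProduct_add,
    dotProduct_smul, dotProduct_smul, dotProduct_single_one, ← hv]
  simp only [smul_eq_mul]
  ring

/-- Entrywise partial derivative of a matrix field. -/
def pdMatrix (A : (Fin n → ℝ) → Matrix (Fin n) (Fin n) ℝ) (k : Fin n) (q : Fin n → ℝ) :
    Matrix (Fin n) (Fin n) ℝ :=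
  of fun i j => pd (fun q => A q i j) k q

/-- The Christoffel symbols `Γ^i_{hj}` as a matrix in `(i, j)`. -/
def christoffelMatrix (g : (Fin n → ℝ) → Matrix (Fin n) (Fin n) ℝ) (h : Fin n) (q : Fin n → ℝ) :
    Matrix (Fin n) (Fin n) ℝ :=
  of fun i j => christoffel g i h j q

theorem pd_congr_of_isOpen {U : Set (Fin n → ℝ)} (hU : IsOpen U) {f f' : (Fin n → ℝ) → ℝ}
    (h : ∀ q ∈ U, f q = f' q) {q : Fin n → ℝ} (hq : q ∈ U) (k : Fin n) :
    pd f k q = pd f' k q := by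
  have : f =ᶠ[nhds q] f' := Filter.eventually_of_mem (hU.mem_nhds hq) h
  rw [pd, pd, this.fderiv_eq]

theorem pdMatrix_mul {A B : (Fin n → ℝ) → Matrix (Fin n) (Fin n) ℝ} {q : Fin n → ℝ}
    (hA : ∀ i j, DifferentiableAt ℝ (fun q => A q i j) q)
    (hB : ∀ i j, DifferentiableAt ℝ (fun q => B q i j) q) (k : Fin n) :
    pdMatrix (fun q => A q * B q) k q = pdMatrix A k q * B q + A q * pdMatrix B k q := by
  ext i j
  have h := HasFDerivAt.fun_sum (u := Finset.univ)
    fun l _ => (hA i l).hasFDerivAt.fun_mul (hB l j).hasFDerivAt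
  refine (congrArg (fun L => L (Pi.single k 1)) h.fderiv).trans ?_
  simp only [_root_.sum_apply, _root_.add_apply, _root_.smul_apply, smul_eq_mul,
    Matrix.add_apply, mul_apply, pdMatrix, of_apply, ← Finset.sum_add_distrib]
  exact Finset.sum_congr rfl fun l _ => by simp only [pd]; ring

theorem differentiableAt_det {A : (Fin n → ℝ) → Matrix (Fin n) (Fin n) ℝ} {q : Fin n → ℝ}
    (hA : ∀ i j, DifferentiableAt ℝ (fun q => A q i j) q) :
    DifferentiableAt ℝ (fun q => (A q).det) q := by
  simp only [det_apply']
  exact DifferentiableAt.fun_sum fun τ _ =>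
    (HasFDerivAt.finsetProd fun i _ => (hA (τ i) i).hasFDerivAt).differentiableAt.const_mul _

theorem differentiableAt_adjugate {A : (Fin n → ℝ) → Matrix (Fin n) (Fin n) ℝ} {q : Fin n → ℝ}
    (hA : ∀ i j, DifferentiableAt ℝ (fun q => A q i j) q) (i j : Fin n) :
    DifferentiableAt ℝ (fun q => (A q).adjugate i j) q := by
  simp only [adjugate_apply]
  refine differentiableAt_det fun a b => ?_
  by_cases h : a = j
  · subst h
    simp
  · simpa [updateRow_apply, h] using hA a b

theorem differentiableAt_matrix_inv {A : (Fin n → ℝ) → Matrix (Fin n) (Fin n) ℝ} {q : Fin n → ℝ}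
    (hA : ∀ i j, DifferentiableAt ℝ (fun q => A q i j) q) (hdet : (A q).det ≠ 0) (i j : Fin n) :
    DifferentiableAt ℝ (fun q => (A q)⁻¹ i j) q := by
  simp only [inv_def, Ring.inverse_eq_inv', Matrix.smul_apply, smul_eq_mul]
  exact ((differentiableAt_det hA).inv hdet).mul (differentiableAt_adjugate hA i j)

theorem differentiableAt_matrix_mul {A B : (Fin n → ℝ) → Matrix (Fin n) (Fin n) ℝ}
    {q : Fin n → ℝ} (hA : ∀ i j, DifferentiableAt ℝ (fun q => A q i j) q)
    (hB : ∀ i j, DifferentiableAt ℝ (fun q => B q i j) q) (i j : Fin n) :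
    DifferentiableAt ℝ (fun q => (A q * B q) i j) q := by
  simp only [mul_apply]
  exact DifferentiableAt.fun_sum fun l _ => (hA i l).mul (hB l j)

theorem pd_quadratic_coefficients {M : (Fin n → ℝ) → Matrix (Fin n) (Fin n) ℝ} {q : Fin n → ℝ}
    (hM : ∀ i j, DifferentiableAt ℝ (fun q => M q i j) q) {V : (Fin n → ℝ) → ℝ}
    (hV : DifferentiableAt ℝ V q) (p : Fin n → ℝ) (k : Fin n) :
    pd (fun q => (1 / 2) * (p ⬝ᵥ M q *ᵥ p) + V q) k q
      = (1 / 2) * (p ⬝ᵥ pdMatrix M k q *ᵥ p) + pd V k q := by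
  have h := ((HasFDerivAt.fun_sum (u := Finset.univ) fun i _ =>
    (HasFDerivAt.fun_sum (u := Finset.univ) fun j _ =>
      (hM i j).hasFDerivAt.mul_const (p j)).const_mul (p i)).const_mul (1 / 2 : ℝ)).fun_add
        hV.hasFDerivAt
  refine (congrArg (fun L => L (Pi.single k 1)) h.fderiv).trans ?_
  simp only [_root_.sum_apply, _root_.add_apply, _root_.smul_apply, smul_eq_mul,
    dotProduct, mulVec, pdMatrix, of_apply, pd, mul_comm]

theorem pd_quadratic_form {M : Matrix (Fin n) (Fin n) ℝ} (hM : Mᵀ = M) (b : ℝ)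
    (p : Fin n → ℝ) (k : Fin n) :
    pd (fun p => (1 / 2) * (p ⬝ᵥ M *ᵥ p) + b) k p = (M *ᵥ p) k := by
  have hp (i : Fin n) : HasFDerivAt (fun p : Fin n → ℝ => p i)
      (ContinuousLinearMap.proj (R := ℝ) (φ := fun _ : Fin n => ℝ) i) p := hasFDerivAt_apply i p
  have h := ((HasFDerivAt.fun_sum (u := Finset.univ) fun i _ =>
    (hp i).fun_mul (HasFDerivAt.fun_sum (u := Finset.univ) fun j _ =>
      (hp j).const_mul (M i j))).const_mul (1 / 2 : ℝ)).add_const b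
  refine (congrArg (fun L => L (Pi.single k 1)) h.fderiv).trans ?_
  have h2 : (1 / 2 : ℝ) * (p ⬝ᵥ M *ᵥ Pi.single k 1 + Pi.single k 1 ⬝ᵥ M *ᵥ p)
      = (M *ᵥ p) k := by
    rw [dotProduct_mulVec_of_transpose_eq hM, dotProduct_single_one, single_one_dotProduct]
    ring
  rw [← h2]
  simp only [_root_.sum_apply, _root_.add_apply, _root_.smul_apply, smul_eq_mul,
    dotProduct, mulVec, ContinuousLinearMap.proj_apply, Finset.sum_add_distrib]
  simp only [mul_comm]

theorem mul_christoffelMatrix_apply {g : (Fin n → ℝ) → Matrix (Fin n) (Fin n) ℝ}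
    {q : Fin n → ℝ} (hg : IsUnit (g q).det) (h i j : Fin n) :
    (g q * christoffelMatrix g h q) i j = (1 / 2) * (pd (fun q => g q i j) h q
      + pd (fun q => g q i h) j q - pd (fun q => g q h j) i q) := by
  have : christoffelMatrix g h q = (g q)⁻¹ * of fun l j => (1 / 2) * (pd (fun q => g q l j) h q
      + pd (fun q => g q l h) j q - pd (fun q => g q h j) l q) := by
    ext a b
    simp only [christoffelMatrix, of_apply, christoffel, mul_apply, Finset.mul_sum]
    exact Finset.sum_congr rfl fun l _ => by ring
  rw [this, mul_nonsing_inv_cancel_left _ _ hg, of_apply]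

section Metric

variable {U : Set (Fin n → ℝ)} {g : (Fin n → ℝ) → Matrix (Fin n) (Fin n) ℝ} {q : Fin n → ℝ}

theorem pd_metric_symm (hU : IsOpen U) (hgsym : ∀ q ∈ U, (g q).IsSymm) (hq : q ∈ U)
    (i j k : Fin n) : pd (fun q => g q i j) k q = pd (fun q => g q j i) k q :=
  pd_congr_of_isOpen hU (fun q hq => (hgsym q hq).apply j i) hq k

theorem christoffelMatrix_symm (hU : IsOpen U) (hgsym : ∀ q ∈ U, (g q).IsSymm) (hq : q ∈ U)
    (h i j : Fin n) : christoffelMatrix g h q i j = christoffelMatrix g j q i h := by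
  simp only [christoffelMatrix, of_apply, christoffel]
  congr 1
  refine Finset.sum_congr rfl fun l _ => ?_
  rw [pd_metric_symm hU hgsym hq h j l]
  ring

theorem pdMatrix_metric (hU : IsOpen U) (hgsym : ∀ q ∈ U, (g q).IsSymm) (hq : q ∈ U)
    (hg : IsUnit (g q).det) (h : Fin n) : pdMatrix g h q
      = g q * christoffelMatrix g h q + (g q * christoffelMatrix g h q)ᵀ := by
  ext i j
  rw [Matrix.add_apply, transpose_apply, mul_christoffelMatrix_apply hg,
    mul_christoffelMatrix_apply hg, pdMatrix, of_apply, pd_metric_symm hU hgsym hq j i h,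
    pd_metric_symm hU hgsym hq i h j, pd_metric_symm hU hgsym hq h j i]
  ring

/-- Lowering the index of the geodesic acceleration. -/
theorem metric_mulVec_geodesic (hg : IsUnit (g q).det) (a v : Fin n → ℝ) (i : Fin n) :
    (g q *ᵥ fun l => a l + ∑ j, ∑ k, christoffel g l j k q * v j * v k) i
      = ∑ j, ((∑ k, pd (fun q => g q i j) k q * v k) * v j + g q i j * a j)
        - (1 / 2) * (v ⬝ᵥ pdMatrix g i q *ᵥ v) := by
  have h1 : (g q *ᵥ fun l => ∑ j, ∑ k, christoffel g l j k q * v j * v k) i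
      = ∑ j, ∑ k, (g q * christoffelMatrix g j q) i k * v j * v k := by
    simp only [mulVec, dotProduct, mul_apply, Finset.mul_sum, Finset.sum_mul]
    rw [Finset.sum_comm]
    refine Finset.sum_congr rfl fun j _ => ?_
    rw [Finset.sum_comm]
    refine Finset.sum_congr rfl fun k _ => Finset.sum_congr rfl fun l _ => ?_
    simp only [christoffelMatrix, of_apply]
    ring
  have h2 : ∑ j, ∑ k, pd (fun q => g q i k) j q * v j * v k
      = ∑ j, ∑ k, pd (fun q => g q i j) k q * v j * v k := by
    rw [Finset.sum_comm]
    exact Finset.sum_congr rfl fun j _ => Finset.sum_congr rfl fun k _ => by ring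
  have h3 : ∑ j, ∑ k, (g q * christoffelMatrix g j q) i k * v j * v k
      = (1 / 2) * (∑ j, ∑ k, pd (fun q => g q i k) j q * v j * v k)
        + (1 / 2) * (∑ j, ∑ k, pd (fun q => g q i j) k q * v j * v k)
        - (1 / 2) * (v ⬝ᵥ pdMatrix g i q *ᵥ v) := by
    simp only [mul_christoffelMatrix_apply hg, dotProduct, mulVec, pdMatrix, of_apply,
      Finset.mul_sum, ← Finset.sum_add_distrib, ← Finset.sum_sub_distrib]
    exact Finset.sum_congr rfl fun j _ => Finset.sum_congr rfl fun k _ => by ring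
  have h4 : (g q *ᵥ fun l => a l + ∑ j, ∑ k, christoffel g l j k q * v j * v k) i
      = (g q *ᵥ a) i + (g q *ᵥ fun l => ∑ j, ∑ k, christoffel g l j k q * v j * v k) i := by
    rw [← Pi.add_apply, ← mulVec_add]
    rfl
  have h5 : ∑ j, (∑ k, pd (fun q => g q i j) k q * v k) * v j
      = ∑ j, ∑ k, pd (fun q => g q i j) k q * v j * v k := by
    simp only [Finset.sum_mul]
    exact Finset.sum_congr rfl fun j _ => Finset.sum_congr rfl fun k _ => by ring
  rw [h4, h1, h3, h2, Finset.sum_add_distrib, h5, mulVec, dotProduct]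
  ring

end Metric

section Symmetry

variable {g J : Matrix (Fin n) (Fin n) ℝ}

theorem metric_mul_eq_transpose_mul (hg : IsUnit g.det) (hgsym : g.IsSymm)
    (hJ : (J * g⁻¹).IsSymm) : g * J = Jᵀ * g := by
  have h : J * g⁻¹ = g⁻¹ * Jᵀ := by
    rw [← hJ.eq, transpose_mul, transpose_nonsing_inv, hgsym.eq]
  calc g * J = g * (J * g⁻¹) * g := by
        rw [Matrix.mul_assoc, Matrix.mul_assoc, nonsing_inv_mul _ hg, Matrix.mul_one]
    _ = Jᵀ * g := by rw [h, mul_nonsing_inv_cancel_left _ _ hg]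

theorem metric_mul_adjugate_eq (hJ : J.det ≠ 0) (h : g * J = Jᵀ * g) :
    g * J.adjugate = J.adjugateᵀ * g := by
  have hJA : J.adjugateᵀ * Jᵀ = J.det • (1 : Matrix (Fin n) (Fin n) ℝ) := by
    rw [← transpose_mul, mul_adjugate, transpose_smul, transpose_one]
  refine smul_right_injective _ hJ ?_
  calc J.det • (g * J.adjugate) = J.adjugateᵀ * Jᵀ * g * J.adjugate := by
        rw [hJA, smul_mul, Matrix.one_mul, smul_mul]
    _ = J.adjugateᵀ * g * (J * J.adjugate) := by
        rw [Matrix.mul_assoc _ Jᵀ, ← h]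
        simp only [Matrix.mul_assoc]
    _ = J.det • (J.adjugateᵀ * g) := by rw [mul_adjugate, Matrix.mul_smul, Matrix.mul_one]

theorem adjugate_mul_inv_transpose (hg : IsUnit g.det) (hgsym : g.IsSymm)
    (h : g * J.adjugate = J.adjugateᵀ * g) :
    (J.adjugate * g⁻¹)ᵀ = J.adjugate * g⁻¹ := by
  rw [transpose_mul, transpose_nonsing_inv, hgsym.eq]
  calc g⁻¹ * J.adjugateᵀ = g⁻¹ * (J.adjugateᵀ * g) * g⁻¹ := by
        rw [Matrix.mul_assoc, Matrix.mul_assoc, mul_nonsing_inv _ hg, Matrix.mul_one]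
    _ = J.adjugate * g⁻¹ := by rw [← h, nonsing_inv_mul_cancel_left _ _ hg]

theorem adjugate_mul_inv_mul (hg : IsUnit g.det) :
    J.adjugate * g⁻¹ * (g * J) = J.det • (1 : Matrix (Fin n) (Fin n) ℝ) := by
  rw [Matrix.mul_assoc, nonsing_inv_mul_cancel_left _ _ hg, adjugate_mul]

theorem inv_adjugate_eq (hJ : J.det ≠ 0) : J.adjugate⁻¹ = J.det⁻¹ • J := by
  refine inv_eq_right_inv ?_
  rw [Matrix.mul_smul, adjugate_mul, smul_smul, inv_mul_cancel₀ hJ, one_smul]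

end Symmetry

/-- Along the momentum `p = g v`, the force of the quasi-Hamiltonian system is the geodesic force
`½ ∂ᵢ g (v, v)` plus the potential force `-(σ⁻¹ Jᵀ dV)ᵢ`, and the velocity is `v`. -/
theorem quasiHamiltonian_vectorField {U : Set (Fin n → ℝ)} (hU : IsOpen U)
    {g J : (Fin n → ℝ) → Matrix (Fin n) (Fin n) ℝ}
    (hg : ∀ i j, ContDiffOn ℝ (⊤ : ℕ∞) (fun q => g q i j) U)
    (hgsym : ∀ q ∈ U, (g q).IsSymm) (hginv : ∀ q ∈ U, IsUnit (g q).det)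
    (hJ : IsJTensor U g J) (hJns : ∀ q ∈ U, (J q).det ≠ 0)
    {V : (Fin n → ℝ) → ℝ} (hV : ContDiffOn ℝ (⊤ : ℕ∞) V U)
    {H : (Fin n → ℝ) → (Fin n → ℝ) → ℝ}
    (hH : H = fun q p => (1 / 2) * (p ⬝ᵥ (((J q).adjugate * (g q)⁻¹) *ᵥ p)) + V q)
    {q : Fin n → ℝ} (hq : q ∈ U) {v p : Fin n → ℝ} (hp : p = g q *ᵥ v) (i : Fin n) :
    (1 / (J q).det) * ∑ j, J q i j * pd (fun p' => H q p') j p = v i ∧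
    (1 / (J q).det) * (- (∑ j, J q j i * pd (fun q' => H q' p) j q)
        + ∑ j, Omega J q p i j * pd (fun p' => H q p') j p)
      = (1 / 2) * (v ⬝ᵥ pdMatrix g i q *ᵥ v)
        - (J q).det⁻¹ * ((J q)ᵀ *ᵥ fun j => pd V j q) i := by
  obtain ⟨hJs, hJsym, α, hα⟩ := hJ
  have hdiff {f : (Fin n → ℝ) → ℝ} (hf : ContDiffOn ℝ (⊤ : ℕ∞) f U) : DifferentiableAt ℝ f q :=
    (hf.contDiffAt (hU.mem_nhds hq)).differentiableAt (by simp)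
  have hgd (i j : Fin n) : DifferentiableAt ℝ (fun q => g q i j) q := hdiff (hg i j)
  have hJd (i j : Fin n) : DifferentiableAt ℝ (fun q => J q i j) q := hdiff (hJs i j)
  have hgq : (g q)ᵀ = g q := (hgsym q hq).eq
  have hσ := hJns q hq
  have hgJ := metric_mul_eq_transpose_mul (hginv q hq) (hgsym q hq) (hJsym q hq)
  have hgA := metric_mul_adjugate_eq hσ hgJ
  have hMt := adjugate_mul_inv_transpose (hginv q hq) (hgsym q hq) hgA
  have hLt : (g q * J q)ᵀ = g q * J q := by rw [transpose_mul, hgq, hgJ]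
  let M : (Fin n → ℝ) → Matrix (Fin n) (Fin n) ℝ := fun q => (J q).adjugate * (g q)⁻¹
  have hMd (i j : Fin n) : DifferentiableAt ℝ (fun q => M q i j) q :=
    differentiableAt_matrix_mul (differentiableAt_adjugate hJd)
      (differentiableAt_matrix_inv hgd (hginv q hq).ne_zero) i j
  obtain ⟨w, hv⟩ : ∃ w, v = J q *ᵥ w := ⟨(J q)⁻¹ *ᵥ v, by
    rw [mulVec_mulVec, mul_nonsing_inv _ (isUnit_iff_ne_zero.2 hσ), one_mulVec]⟩
  have hpw : p = (g q * J q) *ᵥ w := by rw [hp, hv, mulVec_mulVec]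
  have hMp : M q *ᵥ p = (J q).det • w := by
    rw [hpw, mulVec_mulVec, adjugate_mul_inv_mul (hginv q hq), smul_mulVec, one_mulVec]
  have hHp (j : Fin n) : pd (fun p' => H q p') j p = (J q).det * w j := by
    rw [hH]
    refine (pd_quadratic_form hMt (V q) p j).trans ?_
    rw [hMp, Pi.smul_apply, smul_eq_mul]
  have hHq (j : Fin n) : pd (fun q' => H q' p) j q
      = (1 / 2) * (p ⬝ᵥ pdMatrix M j q *ᵥ p) + pd V j q := by
    rw [hH]
    exact pd_quadratic_coefficients hMd (hdiff hV) p j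
  let L : (Fin n → ℝ) → Matrix (Fin n) (Fin n) ℝ := fun q => g q * J q
  have hML (j : Fin n) : pdMatrix M j q * L q + M q * pdMatrix L j q
      = pd (fun q => (J q).det) j q • (1 : Matrix (Fin n) (Fin n) ℝ) := by
    rw [← pdMatrix_mul hMd (differentiableAt_matrix_mul hgd hJd)]
    ext a b
    have h1 : pdMatrix (fun q => M q * L q) j q a b
        = pd (fun q => (J q).det * (1 : Matrix (Fin n) (Fin n) ℝ) a b) j q :=
      pd_congr_of_isOpen hU (fun q hq =>
        congrFun (congrFun (adjugate_mul_inv_mul (hginv q hq)) a) b) hq j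
    rw [h1, pd, ((differentiableAt_det hJd).hasFDerivAt.mul_const _).fderiv]
    simp only [_root_.smul_apply, smul_eq_mul, Matrix.smul_apply, pd]
    ring
  have hkin (j : Fin n) : p ⬝ᵥ pdMatrix M j q *ᵥ p
      = pd (fun q => (J q).det) j q * (w ⬝ᵥ p)
        - (J q).det * (w ⬝ᵥ (pdMatrix g j q * J q + g q * pdMatrix J j q) *ᵥ w) := by
    have h1 : pdMatrix M j q *ᵥ p
        = pd (fun q => (J q).det) j q • w - M q *ᵥ (pdMatrix L j q *ᵥ w) := by
      have h2 : pdMatrix M j q *ᵥ p = (pdMatrix M j q * L q) *ᵥ w := by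
        rw [← mulVec_mulVec, ← hpw]
      rw [h2, eq_sub_of_add_eq (hML j), sub_mulVec, smul_mulVec, one_mulVec, mulVec_mulVec]
    rw [h1, dotProduct_sub, dotProduct_smul, dotProduct_mulVec_of_transpose_eq hMt, hMp,
      smul_dotProduct, pdMatrix_mul hgd hJd, dotProduct_comm p w, smul_eq_mul, smul_eq_mul]
  have hβ : g q *ᵥ ((g q)⁻¹ *ᵥ α q) = α q := by
    rw [mulVec_mulVec, mul_nonsing_inv _ (hginv q hq), one_mulVec]
  have hdJ (h : Fin n) : pdMatrix J h q
      = (of fun i j => α q j * (if i = h then (1 : ℝ) else 0) + ((g q)⁻¹ *ᵥ α q) i * g q j h)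
        - christoffelMatrix g h q * J q + J q * christoffelMatrix g h q := by
    ext a b
    have h1 := hα q hq h a b
    have h2 : (J q * christoffelMatrix g h q) a b
        = ∑ l, christoffel g l h b q * J q a l := by
      simp only [mul_apply, christoffelMatrix, of_apply, mul_comm]
    rw [Matrix.add_apply, h2]
    simp only [Matrix.sub_apply, mul_apply, christoffelMatrix, of_apply, pdMatrix, mulVec,
      dotProduct]
    rw [← h1, covDeriv]
    ring
  have htr : ∑ j, J q j i * pd (fun q => (J q).det) j q = 2 * (J q).det * α q i := by
    simp only [pd_det hJd]
    exact trace_adjugate_contraction (g q) (J q) (fun h => christoffelMatrix g h q)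
      (fun h => pdMatrix J h q) (α q) _ hβ hgA hdJ hgq i
  have hid := kinetic_identity (g q) (J q) (fun h => christoffelMatrix g h q)
    (fun h => pdMatrix g h q) (fun h => pdMatrix J h q) (α q) _ hβ hgq hLt
    (pdMatrix_metric hU hgsym hq (hginv q hq)) (christoffelMatrix_symm hU hgsym hq) hdJ
    w v p hv hp i
  constructor
  · have h1 := congrFun hv i
    rw [h1, mulVec, dotProduct, Finset.mul_sum]
    refine Finset.sum_congr rfl fun j _ => ?_
    rw [hHp]
    field_simp
  · have h1 : ∑ j, J q j i * pd (fun q' => H q' p) j q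
        = (1 / 2) * (2 * (J q).det * α q i) * (w ⬝ᵥ p)
          - (1 / 2) * (J q).det
            * ∑ j, J q j i * (w ⬝ᵥ (pdMatrix g j q * J q + g q * pdMatrix J j q) *ᵥ w)
          + ((J q)ᵀ *ᵥ fun j => pd V j q) i := by
      simp only [hHq, hkin]
      generalize w ⬝ᵥ p = s
      rw [← htr, mulVec, dotProduct, Finset.mul_sum, Finset.mul_sum, Finset.sum_mul,
        ← Finset.sum_sub_distrib, ← Finset.sum_add_distrib]
      refine Finset.sum_congr rfl fun j _ => ?_
      rw [transpose_apply]
      ring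
    have h2 : ∑ j, Omega J q p i j * pd (fun p' => H q p') j p
        = (J q).det
          * ∑ j, (∑ k, (pdMatrix J j q k i - pdMatrix J i q k j) * p k) * w j := by
      rw [Finset.mul_sum]
      refine Finset.sum_congr rfl fun j _ => ?_
      rw [hHp]
      simp only [Omega, pdMatrix, of_apply]
      ring
    rw [h1, h2, hid]
    field_simp
    ring

theorem deriv_momentum {U : Set (Fin n → ℝ)} (hU : IsOpen U)
    {g : (Fin n → ℝ) → Matrix (Fin n) (Fin n) ℝ}
    (hg : ∀ i j, ContDiffOn ℝ (⊤ : ℕ∞) (fun q => g q i j) U) {I : Set ℝ} (hI : IsOpen I)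
    {c : ℝ → (Fin n → ℝ)} (hc : ∀ i, ContDiffOn ℝ (⊤ : ℕ∞) (fun t => c t i) I)
    {t : ℝ} (ht : t ∈ I) (hct : c t ∈ U) (i : Fin n) :
    deriv (fun s => (g (c s) *ᵥ fun j => deriv (fun u => c u j) s) i) t
      = ∑ j, ((∑ k, pd (fun q => g q i j) k (c t) * deriv (fun u => c u k) t)
          * deriv (fun u => c u j) t
        + g (c t) i j * deriv (fun s => deriv (fun u => c u j) s) t) := by
  have hc1 (j : Fin n) : HasDerivAt (fun u => c u j) (deriv (fun u => c u j) t) t :=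
    (((hc j).contDiffAt (hI.mem_nhds ht)).differentiableAt (by simp)).hasDerivAt
  have hc2 (j : Fin n) : HasDerivAt (fun s => deriv (fun u => c u j) s)
      (deriv (fun s => deriv (fun u => c u j) s) t) t :=
    ((((hc j).deriv_of_isOpen (m := 1) hI (by norm_cast)).contDiffAt
      (hI.mem_nhds ht)).differentiableAt (by simp)).hasDerivAt
  have hgc (j : Fin n) : HasDerivAt (fun s => g (c s) i j)
      (∑ k, pd (fun q => g q i j) k (c t) * deriv (fun u => c u k) t) t := by
    have h := (((hg i j).contDiffAt (hU.mem_nhds hct)).differentiableAt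
      (by simp)).hasFDerivAt.comp_hasDerivAt t (hasDerivAt_pi.2 hc1)
    refine h.congr_deriv ?_
    rw [pi_eq_sum_univ' fun k => deriv (fun u => c u k) t, map_sum]
    refine Finset.sum_congr rfl fun k _ => ?_
    rw [map_smul, smul_eq_mul, mul_comm, pd]
  exact (HasDerivAt.fun_sum (u := Finset.univ) fun j _ => (hgc j).fun_mul (hc2 j)).deriv

end CofactorSystems

/-- A curve solves the cofactor Newton system iff its canonical
lift `(q, p = g q̇)` solves the quasi-Hamiltonian system
`d(q,p)/dt = (1/σ) Π_nc(J) dH` with `H = (1/2)pᵀ (cof J) G p + V`. -/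
theorem cofactor_quasiHamiltonian_representation
    (n : ℕ) (U : Set (Fin n → ℝ)) (hU : IsOpen U)
    (g : (Fin n → ℝ) → Matrix (Fin n) (Fin n) ℝ)
    (hg : ∀ i j, ContDiffOn ℝ (⊤ : ℕ∞) (fun q => g q i j) U)
    (hgsym : ∀ q ∈ U, (g q).IsSymm) (hginv : ∀ q ∈ U, IsUnit (g q).det)
    (J : (Fin n → ℝ) → Matrix (Fin n) (Fin n) ℝ)
    (hJ : IsJTensor U g J) (hJns : ∀ q ∈ U, (J q).det ≠ 0)
    (σ : (Fin n → ℝ) → ℝ) (hσ : σ = fun q => (J q).det)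
    (V : (Fin n → ℝ) → ℝ) (hV : ContDiffOn ℝ (⊤ : ℕ∞) V U)
    (H : (Fin n → ℝ) → (Fin n → ℝ) → ℝ)
    (hH : H = fun q p => (1 / 2) * (p ⬝ᵥ (((J q).adjugate * (g q)⁻¹) *ᵥ p)) + V q)
    -- a smooth curve c in U, with its canonical momentum pc = g(c) ċ
    (I : Set ℝ) (hI : IsOpen I)
    (c : ℝ → (Fin n → ℝ)) (hc : ∀ i, ContDiffOn ℝ (⊤ : ℕ∞) (fun t => c t i) I)
    (hcU : ∀ t ∈ I, c t ∈ U)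
    (pc : ℝ → (Fin n → ℝ))
    (hpc : ∀ t, pc t = g (c t) *ᵥ (fun i => deriv (fun s => c s i) t)) :
    -- Newton cofactor system ↔ quasi-Hamiltonian system
    (∀ t ∈ I, ∀ i,
      deriv (fun s => deriv (fun u => c u i) s) t
        + ∑ j, ∑ k, christoffel g i j k (c t)
            * deriv (fun u => c u j) t * deriv (fun u => c u k) t
      = - (((J (c t)).adjugate)⁻¹ *ᵥ grad g V (c t)) i)
    ↔
    (∀ t ∈ I, ∀ i,
      (deriv (fun s => c s i) t
        = (1 / σ (c t)) * ∑ j, J (c t) i j * pd (fun p' => H (c t) p') j (pc t))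
      ∧
      (deriv (fun s => pc s i) t
        = (1 / σ (c t)) *
            (- (∑ j, J (c t) j i * pd (fun q' => H q' (pc t)) j (c t))
              + ∑ j, Omega J (c t) (pc t) i j * pd (fun p' => H (c t) p') j (pc t)))) := by
  subst hσ
  refine forall₂_congr fun t ht => ?_
  have hq := hcU t ht
  have hginvt := hginv _ hq
  set v : Fin n → ℝ := fun i => deriv (fun s => c s i) t with hv
  have hfield := quasiHamiltonian_vectorField hU hg hgsym hginv hJ hJns hV hH hq (hpc t)
  let E : Fin n → ℝ := fun i => deriv (fun s => deriv (fun u => c u i) s) t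
    + ∑ j, ∑ k, christoffel g i j k (c t) * v j * v k
  have hforce : g (c t) *ᵥ (((J (c t)).adjugate)⁻¹ *ᵥ grad g V (c t))
      = (J (c t)).det⁻¹ • ((J (c t))ᵀ *ᵥ fun j => pd V j (c t)) := by
    rw [grad, inv_adjugate_eq (hJns _ hq), smul_mulVec, mulVec_smul, mulVec_mulVec,
      metric_mul_eq_transpose_mul hginvt (hgsym _ hq) (hJ.2.1 _ hq), mulVec_mulVec,
      mul_nonsing_inv_cancel_right _ _ hginvt]
  have hmom (i : Fin n) : deriv (fun s => pc s i) t
      = (g (c t) *ᵥ E) i + (1 / 2) * (v ⬝ᵥ pdMatrix g i (c t) *ᵥ v) := by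
    simp only [hpc]
    rw [deriv_momentum hU hg hI hc ht hq, metric_mulVec_geodesic hginvt]
    ring
  have hnewton : (∀ i, E i = - (((J (c t)).adjugate)⁻¹ *ᵥ grad g V (c t)) i)
      ↔ ∀ i, (g (c t) *ᵥ E) i
        = - ((J (c t)).det⁻¹ * ((J (c t))ᵀ *ᵥ fun j => pd V j (c t)) i) := by
    have hinj : Function.Injective (g (c t)).mulVec :=
      mulVec_injective_iff_isUnit.2 ((isUnit_iff_isUnit_det _).2 hginvt)
    have h := hinj.eq_iff (a := E) (b := -(((J (c t)).adjugate)⁻¹ *ᵥ grad g V (c t)))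
    rw [mulVec_neg, hforce, funext_iff, funext_iff] at h
    exact h.symm
  refine hnewton.trans (forall_congr' fun i => ?_)
  rw [(hfield i).1, (hfield i).2, hmom i, and_iff_right rfl]
  constructor <;> intro h <;> linarith
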